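/- For all reals ε, α with 0 < ε < α < 1/2, there exists a constant C > 0 (depending only on α and ε) such that for every η ∈ ℝ², ∫_{ℝ²} (1+‖η+η̃‖²)^{−α} (1+‖η̃‖²)^{−1} dη̃ ≤ C (1+‖η‖²)^{−(α−ε)}. -/

import Mathlib

open MeasureTheory Set

/-- A weighted product of negative powers is controlled by the power of the smaller factor. -/
lemma rpow_neg_mul_inv_mul_rpow_le {ε α x z w : ℝ} (hε : 0 < ε) (hεα : ε < α) (hα : α < 1)
    (hx : 0 < x) (hz : 0 < z) (hw : 0 < w) (hwxz : w ≤ 2 * (x + z)) :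
    x ^ (-α) * z⁻¹ * w ^ (α - ε) ≤ 4 ^ (α - ε) * (x ^ (-(1 + ε)) + z ^ (-(1 + ε))) := by
  have hβ : 0 ≤ α - ε := by linarith
  rw [← Real.rpow_neg_one z]
  rcases le_total x z with h | h
  · calc x ^ (-α) * z ^ (-1 : ℝ) * w ^ (α - ε)
        ≤ x ^ (-α) * z ^ (-1 : ℝ) * (4 * z) ^ (α - ε) := by
          gcongr; linarith
      _ = 4 ^ (α - ε) * (x ^ (-α) * z ^ (-1 + (α - ε))) := by
          rw [Real.mul_rpow (by norm_num) hz.le, Real.rpow_add hz]; ring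
      _ ≤ 4 ^ (α - ε) * (x ^ (-α) * x ^ (-1 + (α - ε))) := by
          have := Real.rpow_le_rpow_of_nonpos hx h (show -1 + (α - ε) ≤ 0 by linarith)
          gcongr
      _ = 4 ^ (α - ε) * x ^ (-(1 + ε)) := by
          rw [← Real.rpow_add hx]; ring_nf
      _ ≤ _ := by
          gcongr
          exact le_add_of_nonneg_right (by positivity)
  · calc x ^ (-α) * z ^ (-1 : ℝ) * w ^ (α - ε)
        ≤ x ^ (-α) * z ^ (-1 : ℝ) * (4 * x) ^ (α - ε) := by
          gcongr; linarith
      _ = 4 ^ (α - ε) * (x ^ (-ε) * z ^ (-1 : ℝ)) := by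
          rw [Real.mul_rpow (by norm_num) hx.le, show -ε = -α + (α - ε) by ring,
            Real.rpow_add hx]
          ring
      _ ≤ 4 ^ (α - ε) * (z ^ (-ε) * z ^ (-1 : ℝ)) := by
          have := Real.rpow_le_rpow_of_nonpos hz h (show -ε ≤ 0 by linarith)
          gcongr
      _ = 4 ^ (α - ε) * z ^ (-(1 + ε)) := by
          rw [← Real.rpow_add hz]; ring_nf
      _ ≤ _ := by
          gcongr
          exact le_add_of_nonneg_left (by positivity)

lemma one_add_norm_sq_le_two_mul {E : Type*} [SeminormedAddCommGroup E] (x y : E) :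
    1 + ‖x‖ ^ 2 ≤ 2 * ((1 + ‖x + y‖ ^ 2) + (1 + ‖y‖ ^ 2)) := by
  have h : ‖x‖ ≤ ‖x + y‖ + ‖y‖ := by simpa using norm_sub_le (x + y) y
  nlinarith [norm_nonneg x, sq_nonneg (‖x + y‖ - ‖y‖), norm_nonneg y, norm_nonneg (x + y)]

/-- for `0 < ε < α < 1/2` there is a constant `C > 0` such that for every
`η ∈ ℝ²`, `∫_{ℝ²} (1+‖η+η̃‖²)^{−α} (1+‖η̃‖²)^{−1} dη̃ ≤ C (1+‖η‖²)^{−(α−ε)}`. -/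
theorem stmt_5 (ε α : ℝ) (hε : 0 < ε) (hεα : ε < α) (hα : α < 1/2) :
    ∃ C : ℝ, 0 < C ∧ ∀ η : EuclideanSpace ℝ (Fin 2),
      (∫⁻ η' : EuclideanSpace ℝ (Fin 2),
          ENNReal.ofReal ((1 + ‖η + η'‖^2) ^ (-α) * (1 + ‖η'‖^2)⁻¹)) ≤
        ENNReal.ofReal (C * (1 + ‖η‖^2) ^ (-(α - ε))) := by
  let g : EuclideanSpace ℝ (Fin 2) → ℝ := fun y ↦ (1 + ‖y‖ ^ 2) ^ (-(1 + ε))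
  have hg0 : ∀ y, 0 ≤ g y := fun y ↦ by positivity
  have hg : Integrable g := by
    have h := integrable_rpow_neg_one_add_norm_sq (E := EuclideanSpace ℝ (Fin 2))
      (μ := volume) (r := 2 + 2 * ε) (by simp; linarith)
    convert h using 3 with y
    ring
  refine ⟨4 ^ (α - ε) * (2 * ∫ y, g y) + 1, ?_, fun η ↦ ?_⟩
  · have : 0 ≤ ∫ y, g y := integral_nonneg hg0
    positivity
  have hg' : Integrable fun y ↦ g (η + y) := hg.comp_add_left η
  have hsum : Integrable fun y ↦ g (η + y) + g y := hg'.add hg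
  have hw : 0 < 1 + ‖η‖ ^ 2 := by positivity
  calc _ ≤ ∫⁻ y, ENNReal.ofReal
        ((4 ^ (α - ε) * (g (η + y) + g y)) * (1 + ‖η‖ ^ 2) ^ (-(α - ε))) := by
        refine lintegral_mono fun y ↦ ENNReal.ofReal_le_ofReal ?_
        rw [Real.rpow_neg hw.le, le_mul_inv_iff₀ (by positivity)]
        exact rpow_neg_mul_inv_mul_rpow_le hε hεα (by linarith) (by positivity) (by positivity) hw
          (one_add_norm_sq_le_two_mul η y)
    _ = ENNReal.ofReal ((4 ^ (α - ε) * (2 * ∫ y, g y)) * (1 + ‖η‖ ^ 2) ^ (-(α - ε))) := by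
        rw [← ofReal_integral_eq_lintegral_ofReal
          ((hsum.const_mul _).mul_const _)
          (.of_forall fun y ↦ by have := hg0 y; have := hg0 (η + y); positivity),
          integral_mul_const, integral_const_mul, integral_add hg' hg,
          integral_add_left_eq_self g η, two_mul]
    _ ≤ _ := by
        gcongr
        linarith
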